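/- arXiv:2010.07839 — 2 statements merged into one kernel-verified Lean document; each statement's English description precedes it below -/
import Mathlib

section
/- Let b ∈ ℤ^n with Σ_{i=1}^n b_i odd, regarded as a real vector. Then for every real symmetric n×n matrix X lying in the convex hull of the set { x x^T : x ∈ {−1, 1}^n }, the hypermetric inequality ⟨b b^T, X⟩ ≥ 1 holds. -/
/-- Multiplying the terms of an integer sum by odd integers preserves its parity. -/
lemma odd_sum_mul_of_odd {ι : Type*} (s : Finset ι) (b y : ι → ℤ) (hy : ∀ i ∈ s, Odd (y i))
    (hb : Odd (∑ i ∈ s, b i)) : Odd (∑ i ∈ s, b i * y i) := by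
  have h : Even (∑ i ∈ s, b i * (y i - 1)) :=
    Finset.even_sum _ fun i hi => ((hy i hi).sub_odd odd_one).mul_left _
  have h' : ∑ i ∈ s, b i * y i = ∑ i ∈ s, b i * (y i - 1) + ∑ i ∈ s, b i := by
    rw [← Finset.sum_add_distrib]
    exact Finset.sum_congr rfl fun i _ => by ring
  rw [h']
  exact h.add_odd hb

lemma Matrix.trace_vecMulVec_self_mul_vecMulVec_self {ι R : Type*} [Fintype ι] [CommRing R]
    (u v : ι → R) : (vecMulVec u u * vecMulVec v v).trace = (u ⬝ᵥ v) ^ 2 := by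
  rw [vecMulVec_mul_vecMulVec, trace_vecMulVec, dotProduct_smul, smul_eq_mul, sq]

/-- Hypermetric inequality: if `Σ bᵢ` is odd, then `⟨bbᵀ, X⟩ ≥ 1` for every
matrix `X` in the convex hull of `{xxᵀ : x ∈ {−1,1}ⁿ}`. -/
theorem stmt_7 (n : ℕ) (b : Fin n → ℤ) (hb : Odd (∑ i, b i))
    (X : Matrix (Fin n) (Fin n) ℝ) (hXsymm : X.IsSymm)
    (hX : X ∈ convexHull ℝ {M : Matrix (Fin n) (Fin n) ℝ |
      ∃ x : Fin n → ℝ, (∀ i, x i = -1 ∨ x i = 1) ∧ M = Matrix.vecMulVec x x}) :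
    1 ≤ (Matrix.vecMulVec (fun i => (b i : ℝ)) (fun i => (b i : ℝ)) * X).trace := by
  set B := Matrix.vecMulVec (fun i => (b i : ℝ)) (fun i => (b i : ℝ)) with hB
  have hlin : IsLinearMap ℝ fun M : Matrix (Fin n) (Fin n) ℝ => (B * M).trace :=
    ⟨fun M N => by rw [mul_add, Matrix.trace_add],
      fun c M => by rw [Matrix.mul_smul, Matrix.trace_smul]⟩
  refine convexHull_min ?_ (convex_halfSpace_ge hlin 1) hX
  rintro _ ⟨x, hx, rfl⟩
  have hex : ∀ i, ∃ y : ℤ, Odd y ∧ x i = y := fun i => by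
    rcases hx i with h | h
    · exact ⟨-1, by decide, by simp [h]⟩
    · exact ⟨1, by decide, by simp [h]⟩
  choose y hy hxy using hex
  have hodd : Odd (∑ i, b i * y i) := odd_sum_mul_of_odd _ b y (fun i _ => hy i) hb
  have hne : ∑ i, b i * y i ≠ 0 := fun h => by simp [h] at hodd
  have hone : 1 ≤ (∑ i, b i * y i) ^ 2 := Int.add_one_le_iff.mpr (sq_pos_iff.mpr hne)
  have hcast : (fun i => (b i : ℝ)) ⬝ᵥ x = ((∑ i, b i * y i : ℤ) : ℝ) := by
    simp [dotProduct, hxy]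
  change 1 ≤ (B * Matrix.vecMulVec x x).trace
  rw [hB, Matrix.trace_vecMulVec_self_mul_vecMulVec_self, hcast]
  exact_mod_cast hone
end

section
/- Let n ≥ 1 and let X be a real symmetric n×n positive semidefinite matrix with all diagonal entries equal to 1. Then ‖X‖_F^2 = n^2 if and only if X has rank 1. -/
namespace Matrix.PosSemidef

variable {ι : Type*} {X : Matrix ι ι ℝ}

theorem sq_entry_le_one (hX : X.PosSemidef) (hdiag : ∀ i, X i i = 1) (i j : ι) :
    X i j ^ 2 ≤ 1 := by
  have h := (hX.submatrix ![i, j]).det_nonneg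
  have hs : X j i = X i j := by simpa using hX.1.apply i j
  simp only [Matrix.det_fin_two, Matrix.submatrix_apply, Matrix.cons_val, hdiag, hs] at h
  nlinarith

theorem entry_eq_mul_of_sq_eq_one (hX : X.PosSemidef) (hdiag : ∀ i, X i i = 1)
    (hsq : ∀ i j, X i j ^ 2 = 1) (i j k : ι) : X i j = X i k * X k j := by
  have h := (hX.submatrix ![i, j, k]).det_nonneg
  have hs (a b : ι) : X b a = X a b := by simpa using hX.1.apply a b
  simp only [Matrix.det_fin_three, Matrix.submatrix_apply, Matrix.cons_val, hdiag,
    hs i j, hs i k, hs k j] at h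
  have hij := hsq i j
  have hik := hsq i k
  have hkj := hsq k j
  have hsq_prod : (X i k * X k j) ^ 2 = 1 := by rw [mul_pow, hik, hkj, one_mul]
  nlinarith [sq_nonneg (X i j - X i k * X k j)]

end Matrix.PosSemidef

theorem Matrix.exists_eq_vecMulVec_of_rank_eq_one {m n K : Type*} [Fintype n] [DecidableEq n]
    [Field K] {A : Matrix m n K} (hA : A.rank = 1) :
    ∃ (v : m → K) (w : n → K), A = Matrix.vecMulVec v w := by
  obtain ⟨v, -, hv⟩ := finrank_eq_one_iff'.1 hA
  choose c hc using fun j => hv ⟨A.mulVec (Pi.single j 1), Pi.single j 1, rfl⟩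
  refine ⟨v, c, ?_⟩
  ext i j
  have h := congrFun (congrArg Subtype.val (hc j)) i
  simp only [Submodule.coe_smul, Pi.smul_apply, Matrix.mulVec_single_one, Matrix.col_apply,
    smul_eq_mul] at h
  rw [Matrix.vecMulVec_apply, ← h, mul_comm]

/-- For `n ≥ 1`, a PSD matrix with unit diagonal satisfies `‖X‖_F² = n²`
if and only if it has rank 1. -/
theorem stmt_14 (n : ℕ) (hn : 1 ≤ n) (X : Matrix (Fin n) (Fin n) ℝ)
    (hX : X.PosSemidef) (hdiag : ∀ i, X i i = 1) :
    (∑ i, ∑ j, (X i j) ^ 2 = (n : ℝ) ^ 2) ↔ X.rank = 1 := by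
  constructor
  · intro h
    have hsum : ∑ p : Fin n × Fin n, X p.1 p.2 ^ 2 = ∑ _p : Fin n × Fin n, (1 : ℝ) := by
      rw [Fintype.sum_prod_type, h]
      simp [sq]
    have hsq (i j : Fin n) : X i j ^ 2 = 1 :=
      (Finset.sum_eq_sum_iff_of_le fun (p : Fin n × Fin n) _ =>
        hX.sq_entry_le_one hdiag p.1 p.2).1 hsum (i, j) (Finset.mem_univ _)
    let k : Fin n := ⟨0, hn⟩
    have hfac : X = Matrix.vecMulVec (fun i => X i k) (X k) := by
      ext i j
      exact hX.entry_eq_mul_of_sq_eq_one hdiag hsq i j k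
    have hle : X.rank ≤ 1 := hfac ▸ Matrix.rank_vecMulVec_le _ _
    have hne : X.rank ≠ 0 := by
      intro h0
      have hX0 := LinearMap.range_eq_bot.1 (Submodule.finrank_eq_zero.1 h0)
      have h1 := congrFun (LinearMap.congr_fun hX0 (Pi.single k 1)) k
      simp [hdiag] at h1
    omega
  · intro h
    obtain ⟨v, w, hvw⟩ := Matrix.exists_eq_vecMulVec_of_rank_eq_one h
    have hsq (i j : Fin n) : X i j ^ 2 = 1 := by
      have hs : X j i = X i j := by simpa using hX.1.apply i j
      calc X i j ^ 2 = X i j * X j i := by rw [hs, sq]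
        _ = X i i * X j j := by
          simp only [hvw, Matrix.vecMulVec_apply]
          ring
        _ = 1 := by rw [hdiag, hdiag, one_mul]
    simp [hsq, sq]
end
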